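/- Let F = (A, R) be an AF and A_F = ⟨T, F ∪ I ∪ {i_s}⟩ its AF-database. Then for every S ⊆ A: S is preferred in F if and only if S_T is a maximal repair of A_F. -/

import Mathlib

open scoped Classical

universe u

/-- A dependency (functional or inclusion) over an attribute type `α`.
`fd X Y` is the functional dependency `X → Y`; `id X Y` is the inclusion dependency `X ⊆ Y`. -/
inductive Dep (α : Type u) : Type u
  | fd (X Y : List α) : Dep α
  | id (X Y : List α) : Dep α

/-- Satisfaction of a dependency by a set `P` of tuples; tuples are identified by
elements of `ι`, and `val t x` is the value taken by tuple `t` at attribute `x`. -/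
def satDep {ι α V : Type*} (val : ι → α → V) (P : Set ι) : Dep α → Prop
  | Dep.fd X Y => ∀ s ∈ P, ∀ t ∈ P, X.map (val s) = X.map (val t) → Y.map (val s) = Y.map (val t)
  | Dep.id X Y => ∀ s ∈ P, ∃ t ∈ P, X.map (val s) = Y.map (val t)

/-- `P` is a repair of the database instance `⟨T, B⟩`: `P ⊆ T` and `P` satisfies
every dependency in `B`. -/
def IsRepair {ι α V : Type*} (val : ι → α → V) (T : Set ι) (B : Set (Dep α)) (P : Set ι) : Prop :=
  P ⊆ T ∧ ∀ d ∈ B, satDep val P d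

/-- `P` is a maximal repair of `⟨T, B⟩`: a repair such that no repair strictly contains it. -/
def IsMaximalRepair {ι α V : Type*} (val : ι → α → V) (T : Set ι) (B : Set (Dep α))
    (P : Set ι) : Prop :=
  IsRepair val T B P ∧ ∀ P' : Set ι, IsRepair val T B P' → ¬ P ⊂ P'

/-- `supp(X ⊆ Y, s)`: the set of tuples of `T` supporting `s` for the inclusion
dependency `X ⊆ Y`. -/
def suppOf {ι α V : Type*} (val : ι → α → V) (T : Set ι) (X Y : List α) (s : ι) : Set ι :=
  {t ∈ T | Y.map (val t) = X.map (val s)}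

/-- `dom(P[X])`: the set of values taken by the tuples of `P` on the attributes in `X`. -/
def domOn {ι α V : Type*} (val : ι → α → V) (P : Set ι) (X : Set α) : Set V :=
  {v | ∃ s ∈ P, ∃ x ∈ X, val s x = v}

/-- `S` is conflict-free in the AF `(A, R)`. -/
def ConfFree {A : Type u} (R : A → A → Prop) (S : Set A) : Prop :=
  ∀ a ∈ S, ∀ b ∈ S, ¬ R a b

/-- `S` is naive in the AF `(A, R)`. -/
def NaiveExt {A : Type u} (R : A → A → Prop) (S : Set A) : Prop :=
  ConfFree R S ∧ ∀ S' : Set A, ConfFree R S' → ¬ S ⊂ S'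

/-- The argument `a` is defended by `S` in the AF `(A, R)`. -/
def Defends {A : Type u} (R : A → A → Prop) (S : Set A) (a : A) : Prop :=
  ∀ b, R b a → ∃ c ∈ S, R c b

/-- `S` is admissible in the AF `(A, R)`. -/
def AdmissibleExt {A : Type u} (R : A → A → Prop) (S : Set A) : Prop :=
  ConfFree R S ∧ ∀ a ∈ S, Defends R S a

/-- `S` is preferred in the AF `(A, R)`. -/
def PreferredExt {A : Type u} (R : A → A → Prop) (S : Set A) : Prop :=
  AdmissibleExt R S ∧ ∀ S' : Set A, AdmissibleExt R S' → ¬ S ⊂ S'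

/-- The range `S⁺` of `S` in the AF `(A, R)`. -/
def AFRange {A : Type u} (R : A → A → Prop) (S : Set A) : Set A :=
  S ∪ {a | ∃ b ∈ S, R b a}

/-- `S` is stable in the AF `(A, R)`. -/
def StableExt {A : Type u} (R : A → A → Prop) (S : Set A) : Prop :=
  ConfFree R S ∧ ∀ b, b ∉ S → ∃ a ∈ S, R a b

/-- `S` is stage in the AF `(A, R)`. -/
def StageExt {A : Type u} (R : A → A → Prop) (S : Set A) : Prop :=
  ConfFree R S ∧ ∀ S' : Set A, ConfFree R S' → ¬ AFRange R S ⊂ AFRange R S'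

/-- `S` is semi-stable in the AF `(A, R)`. -/
def SemiStableExt {A : Type u} (R : A → A → Prop) (S : Set A) : Prop :=
  AdmissibleExt R S ∧ ∀ S' : Set A, AdmissibleExt R S' → ¬ AFRange R S ⊂ AFRange R S'

/-- `r` is a conflict of the AF `(A, R)`: an unordered pair `{a, b}` with an attack between
`a` and `b` (in either direction). -/
def IsConflict {A : Type u} (R : A → A → Prop) (r : Sym2 A) : Prop :=
  ∃ a b : A, r = s(a, b) ∧ (R a b ∨ R b a)

/-- Valuation of the conflict database `C_F`: one tuple `𝐚` per argument `a`, over the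
attributes `x_r` (`some r`, for conflicts `r`) and the name attribute `n` (`none`), with
`𝐚[n] = a`, `𝐚[x_r] = r` if `a ∈ r`, and `𝐚[x_r] = a` otherwise. -/
noncomputable def confVal {A : Type u} (R : A → A → Prop) (a : A) :
    Option {r : Sym2 A // IsConflict R r} → A ⊕ Sym2 A
  | none => Sum.inl a
  | some r => if a ∈ r.1 then Sum.inr r.1 else Sum.inl a

/-- The dependencies of the conflict database: the FDs `x_r → n` for conflicts `r`. -/
def confDeps {A : Type u} (R : A → A → Prop) :
    Set (Dep (Option {r : Sym2 A // IsConflict R r})) :=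
  {d | ∃ r : {r : Sym2 A // IsConflict R r}, d = Dep.fd [some r] [none]}

/-- Valuation of the defense database `D_F`: attribute `u_b` is `Sum.inl b`, attribute
`v_b` is `Sum.inr b`, and the value `0` is `none`. -/
noncomputable def defVal {A : Type u} (R : A → A → Prop) (a : A) : A ⊕ A → Option A
  | Sum.inl b => if R a b ∨ R b a then some b else none
  | Sum.inr b => if R a b then some b else none

/-- The dependencies of the defense database: the IDs `u_a ⊆ v_a` for `a ∈ A`. -/
def defDeps {A : Type u} (R : A → A → Prop) : Set (Dep (A ⊕ A)) :=
  {d | ∃ a : A, d = Dep.id [Sum.inl a] [Sum.inr a]}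

/-- `r` is a conflict of `(A, R)` on two distinct arguments. -/
def AFConflict {A : Type u} (R : A → A → Prop) (r : Sym2 A) : Prop :=
  ∃ a b : A, r = s(a, b) ∧ a ≠ b ∧ (R a b ∨ R b a)

/-- Attributes of the AF-database `A_F`: `x_r` for conflicts `r` on distinct arguments, the
name attribute `n`, the defense attributes `u_a, v_a` for `a ∈ A`, and `u_s, v_s`. -/
abbrev AFAttr (A : Type u) (R : A → A → Prop) :=
  ({r : Sym2 A // AFConflict R r} ⊕ Unit) ⊕ ((A ⊕ A) ⊕ (Unit ⊕ Unit))

/-- Valuation of the AF-database `A_F`; the fresh value `0` is `none`. -/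
noncomputable def afVal {A : Type u} (R : A → A → Prop) (a : A) :
    AFAttr A R → Option (A ⊕ Sym2 A)
  | Sum.inl (Sum.inl r) => if a ∈ r.1 then some (Sum.inr r.1) else some (Sum.inl a)
  | Sum.inl (Sum.inr _) => some (Sum.inl a)
  | Sum.inr (Sum.inl (Sum.inl b)) =>
      if a ≠ b ∧ (R a b ∨ R b a) then some (Sum.inl b) else none
  | Sum.inr (Sum.inl (Sum.inr b)) =>
      if a ≠ b ∧ R a b then some (Sum.inl b) else none
  | Sum.inr (Sum.inr (Sum.inl _)) => if R a a then some (Sum.inl a) else none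
  | Sum.inr (Sum.inr (Sum.inr _)) => none

/-- The FDs `x_r → n` of the AF-database. -/
def afFDs (A : Type u) (R : A → A → Prop) : Set (Dep (AFAttr A R)) :=
  {d | ∃ r : {r : Sym2 A // AFConflict R r},
    d = Dep.fd [Sum.inl (Sum.inl r)] [Sum.inl (Sum.inr ())]}

/-- The IDs `u_a ⊆ v_a` of the AF-database. -/
def afIDs (A : Type u) (R : A → A → Prop) : Set (Dep (AFAttr A R)) :=
  {d | ∃ a : A, d = Dep.id [Sum.inr (Sum.inl (Sum.inl a))] [Sum.inr (Sum.inl (Sum.inr a))]}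

/-- The ID `i_s = (u_s ⊆ v_s)` for self-attacking arguments. -/
def afIs (A : Type u) (R : A → A → Prop) : Dep (AFAttr A R) :=
  Dep.id [Sum.inr (Sum.inr (Sum.inl ()))] [Sum.inr (Sum.inr (Sum.inr ()))]

/-- All dependencies `F ∪ I ∪ {i_s}` of the AF-database. -/
def afDeps (A : Type u) (R : A → A → Prop) : Set (Dep (AFAttr A R)) :=
  afFDs A R ∪ afIDs A R ∪ {afIs A R}

/-- The range attributes `X_r = {v_a : a ∈ A} ∪ {n}`. -/
def rangeAttrs (A : Type u) (R : A → A → Prop) : Set (AFAttr A R) :=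
  {x | (∃ a : A, x = Sum.inr (Sum.inl (Sum.inr a))) ∨ x = Sum.inl (Sum.inr ())}

/-- The FDs of the AF-database hold on `S` iff distinct members of `S` do not attack each other. -/
theorem satDep_afFDs_iff {A : Type u} (R : A → A → Prop) (S : Set A) :
    (∀ d ∈ afFDs A R, satDep (afVal R) S d) ↔ ∀ a ∈ S, ∀ b ∈ S, a ≠ b → ¬ R a b := by
  constructor
  · intro h a ha b hb hab hR
    have hfd := h _ ⟨⟨s(a, b), a, b, rfl, hab, Or.inl hR⟩, rfl⟩ a ha b hb
    exact hab (by simpa [afVal] using hfd)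
  · rintro h _ ⟨⟨_, a, b, rfl, -, hR⟩, rfl⟩
    intro s hs t ht hst
    simp only [List.map_cons, List.map_nil, afVal, List.cons.injEq, and_true, Sym2.mem_iff,
      Option.some.injEq, Sum.inl.injEq] at hst ⊢
    split_ifs at hst <;> grind

/-- The IDs `u_a ⊆ v_a` hold on `S` iff `S` defends its members against all attacks by other
arguments, without using self-attacks. -/
theorem satDep_afIDs_iff {A : Type u} (R : A → A → Prop) (S : Set A) :
    (∀ d ∈ afIDs A R, satDep (afVal R) S d) ↔
      ∀ s ∈ S, ∀ a, s ≠ a → R a s → ∃ t ∈ S, t ≠ a ∧ R t a := by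
  constructor
  · intro h s hs a hsa hR
    obtain ⟨t, ht, hst⟩ := h _ ⟨a, rfl⟩ s hs
    refine ⟨t, ht, ?_⟩
    by_contra hta
    simp only [List.map_cons, List.map_nil, afVal, if_pos (And.intro hsa (Or.inr hR)),
      if_neg hta] at hst
    simp at hst
  · rintro h _ ⟨a, rfl⟩ s hs
    by_cases hsa : s ≠ a ∧ (R s a ∨ R a s)
    · obtain ⟨t, ht, hta⟩ : ∃ t ∈ S, t ≠ a ∧ R t a :=
        hsa.2.elim (fun hR => ⟨s, hs, hsa.1, hR⟩) (h s hs a hsa.1)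
      exact ⟨t, ht, by simp only [List.map_cons, List.map_nil, afVal, if_pos hsa, if_pos hta]⟩
    · have hsa' : ¬ (s ≠ a ∧ R s a) := fun hR => hsa ⟨hR.1, Or.inl hR.2⟩
      exact ⟨s, hs, by simp only [List.map_cons, List.map_nil, afVal, if_neg hsa, if_neg hsa']⟩

/-- The ID `u_s ⊆ v_s` holds on `S` iff no member of `S` attacks itself. -/
theorem satDep_afIs_iff {A : Type u} (R : A → A → Prop) (S : Set A) :
    satDep (afVal R) S (afIs A R) ↔ ∀ a ∈ S, ¬ R a a := by
  constructor
  · intro h a ha hR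
    obtain ⟨t, -, hat⟩ := h a ha
    simp [afVal, hR] at hat
  · intro h a ha
    exact ⟨a, ha, by simp [afVal, h a ha]⟩

/-- The repairs of the AF-database are the admissible sets. -/
theorem isRepair_afDeps_iff {A : Type u} (R : A → A → Prop) (S : Set A) :
    IsRepair (afVal R) Set.univ (afDeps A R) S ↔ AdmissibleExt R S := by
  have hsplit : IsRepair (afVal R) Set.univ (afDeps A R) S ↔
      ((∀ d ∈ afFDs A R, satDep (afVal R) S d) ∧ ∀ d ∈ afIDs A R, satDep (afVal R) S d) ∧
        satDep (afVal R) S (afIs A R) := by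
    simp only [IsRepair, afDeps, Set.subset_univ, true_and, Set.mem_union, Set.mem_singleton_iff,
      or_imp, forall_and, forall_eq]
  rw [hsplit, satDep_afFDs_iff, satDep_afIDs_iff, satDep_afIs_iff]
  constructor
  · rintro ⟨⟨hconf, hdef⟩, hself⟩
    refine ⟨fun a ha b hb hR => ?_, fun a ha b hR => ?_⟩
    · by_cases hab : a = b
      · exact hself a ha (hab ▸ hR)
      · exact hconf a ha b hb hab hR
    · have hab : a ≠ b := fun hab => hself a ha (by rwa [← hab] at hR)
      obtain ⟨t, ht, -, htb⟩ := hdef a ha b hab hR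
      exact ⟨t, ht, htb⟩
  · rintro ⟨hconf, hdef⟩
    refine ⟨⟨fun a ha b hb _ => hconf a ha b hb, fun a ha b _ hR => ?_⟩,
      fun a ha => hconf a ha a ha⟩
    obtain ⟨t, ht, htb⟩ := hdef a ha b hR
    exact ⟨t, ht, fun h => hconf b (h ▸ ht) a ha hR, htb⟩

/-- For an AF `F = (A, R)` and its AF-database `A_F = ⟨T, F ∪ I ∪ {i_s}⟩`,
a set `S ⊆ A` is preferred in `F` iff the corresponding set of tuples `S_T` is a maximal
repair of `A_F`. -/
theorem preferred_iff_maximalRepair {A : Type u} [Fintype A] [Nonempty A]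
    (R : A → A → Prop) (S : Set A) :
    PreferredExt R S ↔ IsMaximalRepair (afVal R) Set.univ (afDeps A R) S := by
  simp only [PreferredExt, IsMaximalRepair, isRepair_afDeps_iff]
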